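/- arXiv:math/0009226 — 2 statements merged into one kernel-verified Lean document; each statement's English description precedes it below -/
import Mathlib

section
/- Let x = (x₁,x₂,x₃,x₄) ∈ ℂ⁴ and n = 1 + |x₁|² + |x₂|² + |x₃|² + |x₄|². Then A(x) is invertible and det( (1/n)·(C(x) − conj(B(x))ᵀ·A(x)⁻¹·B(x)) ) = |x₁|²·|x₂|²·|x₃|²·|x₄|² / n. -/
/- STATEMENT 10: For every x ∈ ℂ⁴, A(x) is invertible and
det( (1/n)(C(x) − conj(B(x))ᵀ A(x)⁻¹ B(x)) ) = |x₁|²|x₂|²|x₃|²|x₄|²/n,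
i.e. the determinant of the natural metric of E(−2) (the induced metric on
det E(−2)) has this explicit form. Here x 0,…,x 3 stand for x₁,…,x₄. -/

open Matrix

noncomputable section

/-- n = 1 + Σ |x_i|², as a complex number. -/
def nC (x : Fin 4 → ℂ) : ℂ := 1 + ∑ i, star (x i) * x i

/-- The 5×5 matrix A(x). -/
def Amat (x : Fin 4 → ℂ) : Matrix (Fin 5) (Fin 5) ℂ :=
  !![nC x + 1, star (x 1) * x 3, star (x 3) * x 2, star (x 0) * x 1, star (x 2) * x 0;
     star (x 3) * x 1, nC x + star (x 0) * x 0, star (x 2), x 3, star (x 1) * x 2;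
     star (x 2) * x 3, x 2, nC x + star (x 1) * x 1, star (x 3) * x 0, star (x 0);
     star (x 1) * x 0, star (x 3), star (x 0) * x 3, nC x + star (x 2) * x 2, x 1;
     star (x 0) * x 2, star (x 2) * x 1, x 0, star (x 1), nC x + star (x 3) * x 3]

/-- The 5×2 matrix B(x). -/
def Bmat (x : Fin 4 → ℂ) : Matrix (Fin 5) (Fin 2) ℂ :=
  !![(star (x 0) * x 0 + star (x 3) * x 3) * star (x 1) * star (x 2),
       -(star (x 1) * x 1 + star (x 2) * x 2) * star (x 0) * star (x 3);
     (1 + star (x 1) * x 1) * star (x 2) * star (x 3),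
       -(star (x 2) * x 2 + star (x 3) * x 3) * star (x 1);
     (star (x 0) * x 0 + star (x 2) * x 2) * star (x 3),
       -(1 + star (x 3) * x 3) * star (x 0) * star (x 2);
     (star (x 1) * x 1 + star (x 3) * x 3) * star (x 0),
       -(1 + star (x 0) * x 0) * star (x 1) * star (x 3);
     (1 + star (x 2) * x 2) * star (x 0) * star (x 1),
       -(star (x 0) * x 0 + star (x 1) * x 1) * star (x 2)]

/-- The 2×2 diagonal matrix C(x) = diag(c₁,c₂). -/
def Cmat (x : Fin 4 → ℂ) : Matrix (Fin 2) (Fin 2) ℂ :=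
  !![star (x 0) * x 0 * (star (x 1) * x 1) * (1 + star (x 2) * x 2)
       + star (x 0) * x 0 * (star (x 3) * x 3)
       + star (x 2) * x 2 * (star (x 3) * x 3) * (1 + star (x 1) * x 1), 0;
     0, star (x 0) * x 0 * (star (x 2) * x 2) * (1 + star (x 3) * x 3)
       + star (x 1) * x 1 * (star (x 2) * x 2)
       + star (x 1) * x 1 * (star (x 3) * x 3) * (1 + star (x 0) * x 0)]

/-- The matrix H(x) = (1/n)·(C − Bᴴ·A⁻¹·B) of the natural metric of E(−2). -/
def Hmat (x : Fin 4 → ℂ) : Matrix (Fin 2) (Fin 2) ℂ :=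
  (1 / nC x) • (Cmat x - (Bmat x)ᴴ * (Amat x)⁻¹ * Bmat x)

/-- Gram matrix of the metric on the second exterior power of the quotient by z = (1,x),
in the basis e12, e13, e14, e23, e24, e34. -/
def hmG (x : Fin 4 → ℂ) : Matrix (Fin 6) (Fin 6) ℂ :=
  !![1 + x 2 * star (x 2) + x 3 * star (x 3), -(x 2 * star (x 1)), -(x 3 * star (x 1)), x 2 * star (x 0), x 3 * star (x 0), 0;
     -(x 1 * star (x 2)), 1 + x 1 * star (x 1) + x 3 * star (x 3), -(x 3 * star (x 2)), -(x 1 * star (x 0)), 0, x 3 * star (x 0);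
     -(x 1 * star (x 3)), -(x 2 * star (x 3)), 1 + x 1 * star (x 1) + x 2 * star (x 2), 0, -(x 1 * star (x 0)), -(x 2 * star (x 0));
     x 0 * star (x 2), -(x 0 * star (x 1)), 0, 1 + x 0 * star (x 0) + x 3 * star (x 3), -(x 3 * star (x 2)), x 3 * star (x 1);
     x 0 * star (x 3), 0, -(x 0 * star (x 1)), -(x 2 * star (x 3)), 1 + x 0 * star (x 0) + x 2 * star (x 2), -(x 2 * star (x 1));
     0, x 0 * star (x 3), -(x 0 * star (x 2)), x 1 * star (x 3), -(x 1 * star (x 2)), 1 + x 0 * star (x 0) + x 1 * star (x 1)]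

/-- Wedge pairing on the second exterior power of a 4-dimensional space. -/
def hmL : Matrix (Fin 6) (Fin 6) ℂ :=
  !![0, 0, 0, 0, 0, 1;
     0, 0, 0, 0, -1, 0;
     0, 0, 0, 1, 0, 0;
     0, 0, 1, 0, 0, 0;
     0, -1, 0, 0, 0, 0;
     1, 0, 0, 0, 0, 0]

/-- First component of the monad map. -/
def hmM1 (x : Fin 4 → ℂ) : Matrix (Fin 5) (Fin 6) ℂ :=
  !![0, 0, 0, 1, 0, 0;
     0, 0, 0, 0, 0, 1;
     0, 0, x 0, 0, x 1, x 2;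
     x 1, x 2, x 3, 0, 0, 0;
     1, 0, 0, 0, 0, 0]

/-- Second component of the monad map. -/
def hmM2 (x : Fin 4 → ℂ) : Matrix (Fin 5) (Fin 6) ℂ :=
  !![0, 0, 1, 0, 0, 0;
     x 0, 0, 0, -x 2, -x 3, 0;
     0, -1, 0, 0, 0, 0;
     0, 0, 0, 0, -1, 0;
     0, -x 0, 0, -x 1, 0, x 3]

/-- First component of the two sections. -/
def hmS1 (x : Fin 4 → ℂ) : Matrix (Fin 2) (Fin 6) ℂ :=
  !![x 0 * x 1, 0, x 0 * x 3, 0, 0, x 2 * x 3;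
     0, 0, 0, 0, 0, 0]

/-- Second component of the two sections. -/
def hmS2 (x : Fin 4 → ℂ) : Matrix (Fin 2) (Fin 6) ℂ :=
  !![0, 0, 0, 0, 0, 0;
     0, x 0 * x 2, 0, x 1 * x 2, x 1 * x 3, 0]

theorem hm_G_herm (x : Fin 4 → ℂ) : (hmG x)ᴴ = hmG x := by
  ext i j
  fin_cases i <;> fin_cases j <;> simp [hmG, conjTranspose_apply] <;> ring

theorem hm_L_sq : hmL * hmL = 1 := by
  ext i j
  simp only [Matrix.add_apply, Matrix.sub_apply, Matrix.mul_apply, Fin.sum_univ_six,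
   Matrix.transpose_apply, Matrix.conjTranspose_apply, Matrix.of_apply]
  fin_cases i <;> fin_cases j <;> simp [hmL]

theorem hm_L_transpose : hmLᵀ = hmL := by
  ext i j
  fin_cases i <;> fin_cases j <;> simp [hmL]

theorem hm_L_conjTranspose : hmLᴴ = hmL := by
  ext i j
  fin_cases i <;> fin_cases j <;> simp [hmL, conjTranspose_apply]

set_option maxHeartbeats 4000000 in
theorem hm_G_inv (x : Fin 4 → ℂ) : hmG x * (hmL * (hmG x)ᵀ * hmL) = nC x • 1 := by
  have h : hmL * (hmG x)ᵀ * hmL = Matrix.of fun i j =>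
      (![1, -1, 1, 1, -1, 1] i * ![1, -1, 1, 1, -1, 1] j : ℂ) * hmG x j.rev i.rev := by
    ext i j
    simp only [Matrix.add_apply, Matrix.sub_apply, Matrix.mul_apply, Fin.sum_univ_six,
     Matrix.transpose_apply, Matrix.conjTranspose_apply, Matrix.of_apply]
    fin_cases i <;> fin_cases j <;>
      simp [hmG, hmL, Fin.rev]
  rw [h]
  ext i j
  simp only [Matrix.add_apply, Matrix.sub_apply, Matrix.mul_apply, Fin.sum_univ_six,
   Matrix.transpose_apply, Matrix.conjTranspose_apply, Matrix.of_apply]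
  fin_cases i <;> fin_cases j <;>
    simp [hmG, nC, Fin.rev, Fin.sum_univ_succ] <;> ring

theorem hm_A (x : Fin 4 → ℂ) :
    hmM1 x * hmG x * (hmM1 x)ᴴ + hmM2 x * hmG x * (hmM2 x)ᴴ = Amat x := by
  ext i j
  simp only [Matrix.add_apply, Matrix.sub_apply, Matrix.mul_apply, Fin.sum_univ_six,
   Matrix.transpose_apply, Matrix.conjTranspose_apply, Matrix.of_apply]
  fin_cases i <;> fin_cases j <;>
    simp [hmG, hmM1, hmM2, Amat, nC, Fin.sum_univ_succ] <;> ring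

theorem hm_B (x : Fin 4 → ℂ) :
    hmM1 x * hmG x * (hmS1 x)ᴴ + hmM2 x * hmG x * (hmS2 x)ᴴ = Bmat x := by
  ext i j
  simp only [Matrix.add_apply, Matrix.sub_apply, Matrix.mul_apply, Fin.sum_univ_six,
   Matrix.transpose_apply, Matrix.conjTranspose_apply, Matrix.of_apply]
  fin_cases i <;> fin_cases j <;>
    simp [hmG, hmM1, hmM2, hmS1, hmS2, Bmat] <;> ring

theorem hm_C (x : Fin 4 → ℂ) :
    hmS1 x * hmG x * (hmS1 x)ᴴ + hmS2 x * hmG x * (hmS2 x)ᴴ = Cmat x := by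
  ext i j
  simp only [Matrix.add_apply, Matrix.sub_apply, Matrix.mul_apply, Fin.sum_univ_six,
   Matrix.transpose_apply, Matrix.conjTranspose_apply, Matrix.of_apply]
  fin_cases i <;> fin_cases j <;>
    simp [hmG, hmS1, hmS2, Cmat] <;> ring

theorem hm_MM (x : Fin 4 → ℂ) :
    hmM1 x * hmL * (hmM2 x)ᵀ - hmM2 x * hmL * (hmM1 x)ᵀ = 0 := by
  ext i j
  simp only [Matrix.add_apply, Matrix.sub_apply, Matrix.mul_apply, Fin.sum_univ_six,
   Matrix.transpose_apply, Matrix.conjTranspose_apply, Matrix.of_apply]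
  fin_cases i <;> fin_cases j <;>
    simp [hmL, hmM1, hmM2] <;> ring

theorem hm_MS (x : Fin 4 → ℂ) :
    hmM1 x * hmL * (hmS2 x)ᵀ - hmM2 x * hmL * (hmS1 x)ᵀ = 0 := by
  ext i j
  simp only [Matrix.add_apply, Matrix.sub_apply, Matrix.mul_apply, Fin.sum_univ_six,
   Matrix.transpose_apply, Matrix.conjTranspose_apply, Matrix.of_apply]
  fin_cases i <;> fin_cases j <;>
    simp [hmL, hmM1, hmM2, hmS1, hmS2] <;> ring

theorem hm_SS (x : Fin 4 → ℂ) :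
    hmS1 x * hmL * (hmS2 x)ᵀ - hmS2 x * hmL * (hmS1 x)ᵀ =
      !![0, x 0 * x 1 * x 2 * x 3; -(x 0 * x 1 * x 2 * x 3), 0] := by
  ext i j
  simp only [Matrix.add_apply, Matrix.sub_apply, Matrix.mul_apply, Fin.sum_univ_six,
   Matrix.transpose_apply, Matrix.conjTranspose_apply, Matrix.of_apply]
  fin_cases i <;> fin_cases j <;>
    simp [hmL, hmS1, hmS2] <;> ring

theorem hm_nC (x : Fin 4 → ℂ) : nC x ≠ 0 := by
  have h : nC x = ((1 + ∑ i, Complex.normSq (x i) : ℝ) : ℂ) := by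
    simp [nC, Complex.normSq_eq_conj_mul_self]
  rw [h]
  have : (0:ℝ) < 1 + ∑ i, Complex.normSq (x i) := by
    have := Finset.sum_nonneg (s := Finset.univ) fun i _ => Complex.normSq_nonneg (x i)
    linarith
  exact_mod_cast this.ne'

/-- The vectors whose squared norms sum up to the Hermitian form of A. -/
def hmSq (x : Fin 4 → ℂ) (v : Fin 5 → ℂ) : Fin 20 → ℂ :=
  ![v 0,
      v 1 * x 0,
      v 2 * x 1,
      v 3 * x 2,
      v 4 * x 3,
      v 0,
      v 1 * x 0,
      v 2 * x 1,
      v 3 * x 2,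
      v 4 * x 3,
      v 0 * x 1 + v 1 * x 3,
      v 1 * x 2 + v 2,
      v 2 * x 3 + v 3 * x 0,
      v 3 + v 4 * x 1,
      v 4 * x 0 + v 0 * x 2,
      v 0 * x 3 + v 2 * x 2,
      v 1 + v 3 * x 3,
      v 2 * x 0 + v 4,
      v 3 * x 1 + v 0 * x 0,
      v 4 * x 2 + v 1 * x 1]

theorem hm_A_form (x : Fin 4 → ℂ) (v : Fin 5 → ℂ) :
    star v ⬝ᵥ (Amat x *ᵥ v) = ∑ t, star (hmSq x v t) * hmSq x v t := by
  simp [hmSq, Amat, nC, Matrix.mulVec, dotProduct, Fin.sum_univ_succ]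
  ring

theorem hm_A_unit (x : Fin 4 → ℂ) : IsUnit (Amat x) := by
  rw [← Matrix.mulVec_injective_iff_isUnit]
  rw [← Matrix.coe_mulVecLin, ← LinearMap.ker_eq_bot, LinearMap.ker_eq_bot']
  intro v hv
  have hv' : Amat x *ᵥ v = 0 := hv
  have hq := hm_A_form x v
  rw [hv', dotProduct_zero] at hq
  have hr : ∑ t, Complex.normSq (hmSq x v t) = 0 := by
    have : ((∑ t, Complex.normSq (hmSq x v t) : ℝ) : ℂ) = 0 := by
      rw [hq]
      push_cast
      exact Finset.sum_congr rfl fun t _ => Complex.normSq_eq_conj_mul_self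
    exact_mod_cast this
  have hz : ∀ t, hmSq x v t = 0 := by
    intro t
    have := (Finset.sum_eq_zero_iff_of_nonneg
      (fun t _ => Complex.normSq_nonneg (hmSq x v t))).1 hr t (Finset.mem_univ t)
    exact Complex.normSq_eq_zero.1 this
  have h0 : v 0 = 0 := hz 0
  have d1 : v 1 * x 0 = 0 := hz 1
  have r1 : v 1 + v 3 * x 3 = 0 := hz 16
  have r2 : v 1 * x 2 + v 2 = 0 := hz 11
  have r3 : v 3 + v 4 * x 1 = 0 := hz 13
  have r4 : v 2 * x 0 + v 4 = 0 := hz 17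
  have h1 : v 1 = 0 := by
    rcases mul_eq_zero.1 d1 with h | h
    · exact h
    · have h4 : v 4 = 0 := by simpa [h] using r4
      have h3 : v 3 = 0 := by simpa [h4] using r3
      simpa [h3] using r1
  have h2 : v 2 = 0 := by simpa [h1] using r2
  have h4 : v 4 = 0 := by simpa [h2] using r4
  have h3 : v 3 = 0 := by simpa [h4] using r3
  ext i
  fin_cases i <;> simp [h0, h1, h2, h3, h4]

theorem hm_det_rect {m k : Type*} [Fintype m] [DecidableEq m] [Fintype k] [DecidableEq k]
    (e : m ≃ k) (T : Matrix m k ℂ) (X : Matrix k k ℂ) (U : Matrix k m ℂ) :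
    (T * X * U).det = (T.submatrix id e).det * X.det * (U.submatrix e id).det := by
  rw [← det_submatrix_equiv_self e X, ← det_mul, ← det_mul, submatrix_mul_equiv,
    submatrix_mul_equiv, submatrix_id_id]

/-- Abstract linear algebra: the determinant of the metric on the cohomology of a self-dual monad. -/
theorem hm_key {k : Type*} [Fintype k] [DecidableEq k] (e : Fin 5 ⊕ (Fin 2 ⊕ Fin 5) ≃ k)
    (M : Matrix (Fin 5) k ℂ) (S : Matrix (Fin 2) k ℂ) (G H W : Matrix k k ℂ)
    (A : Matrix (Fin 5) (Fin 5) ℂ) (B : Matrix (Fin 5) (Fin 2) ℂ) (C : Matrix (Fin 2) (Fin 2) ℂ)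
    (n s : ℂ) (hn : n ≠ 0) (hAu : IsUnit A)
    (hA : M * G * Mᴴ = A) (hB : M * G * Sᴴ = B) (hC : S * G * Sᴴ = C)
    (hG : Gᴴ = G) (hH : Hᴴ = H) (hGH : G * H = n • 1) (hdG : G.det = n ^ 6)
    (hWT : Wᵀ = -W) (hWH : Wᴴ = -W) (hWW : W * W = -1) (hWHW : W * H * W = -Gᵀ)
    (hMM : M * W * Mᵀ = 0) (hMS : M * W * Sᵀ = 0) (hSS : (S * W * Sᵀ).det = s ^ 2) :
    (C - Bᴴ * A⁻¹ * B).det = n * (star s * s) := by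
  have hAH : Aᴴ = A := by
    rw [← hA]
    simp only [conjTranspose_mul, hG, conjTranspose_conjTranspose, Matrix.mul_assoc]
  have hBH : S * G * Mᴴ = Bᴴ := by
    rw [← hB]
    simp only [conjTranspose_mul, hG, conjTranspose_conjTranspose, Matrix.mul_assoc]
  have hSM : S * W * Mᵀ = 0 := by
    have h := congrArg transpose hMS
    simp only [transpose_mul, transpose_transpose, hWT, transpose_zero] at h
    simpa [Matrix.mul_assoc] using h
  obtain ⟨R, hR⟩ : ∃ R : Matrix (Fin 5) k ℂ, R = Mᴴᵀ * W * H := ⟨_, rfl⟩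
  have hRH : Rᴴ = -(H * (W * Mᵀ)) := by
    have : Mᴴᵀᴴ = Mᵀ := by
      ext i j; simp
    rw [hR]
    simp [conjTranspose_mul, hH, hWH, this]
  have hGR : G * Rᴴ = -(n • (W * Mᵀ)) := by
    rw [hRH, Matrix.mul_neg, ← Matrix.mul_assoc, hGH]
    simp
  have hMR : M * G * Rᴴ = 0 := by
    rw [Matrix.mul_assoc, hGR]
    simp [← Matrix.mul_assoc, hMM]
  have hSR : S * G * Rᴴ = 0 := by
    rw [Matrix.mul_assoc, hGR]
    simp [← Matrix.mul_assoc, hSM]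
  have hRM : R * G * Mᴴ = 0 := by
    have h := congrArg conjTranspose hMR
    simpa [conjTranspose_mul, hG, Matrix.mul_assoc] using h
  have hRS : R * G * Sᴴ = 0 := by
    have h := congrArg conjTranspose hSR
    simpa [conjTranspose_mul, hG, Matrix.mul_assoc] using h
  have hRWM : R * W * Mᵀ = -Aᵀ := by
    calc R * W * Mᵀ = Mᴴᵀ * (W * H * W) * Mᵀ := by rw [hR]; simp only [Matrix.mul_assoc]
      _ = -Aᵀ := by
        rw [hWHW, ← hA]
        simp [transpose_mul, Matrix.mul_assoc]
  have hRR : R * G * Rᴴ = n • Aᵀ := by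
    rw [Matrix.mul_assoc, hGR]
    have : R * (W * Mᵀ) = -Aᵀ := by rw [← Matrix.mul_assoc, hRWM]
    simp [this]
  have hMWR : M * W * Rᵀ = A := by
    have h := congrArg transpose hRWM
    simp only [transpose_mul, transpose_transpose, hWT, transpose_neg] at h
    simpa [Matrix.mul_assoc] using h
  obtain ⟨T, hT⟩ : ∃ T, T = fromRows M (fromRows S R) := ⟨_, rfl⟩
  obtain ⟨t, ht⟩ : ∃ t, t = (T.submatrix id e).det := ⟨_, rfl⟩
  -- the Hermitian Gram determinant
  have E1 : t * n ^ 6 * star t = A.det * ((C - Bᴴ * A⁻¹ * B).det * (n ^ 5 * A.det)) := by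
    have h1 : (T * G * Tᴴ).det = t * n ^ 6 * star t := by
      rw [hm_det_rect e, hdG, ← ht]
      congr 1
      rw [← conjTranspose_submatrix, det_conjTranspose, ht]
    have h2 : T * G * Tᴴ = fromBlocks A (fromCols B 0) (fromRows Bᴴ 0)
        (fromBlocks C 0 0 (n • Aᵀ)) := by
      rw [hT]
      simp only [conjTranspose_fromRows_eq_fromCols_conjTranspose, fromRows_mul,
        mul_fromCols, hA, hB, hC, hBH, hMR, hSR, hRM, hRS, hRR]
      ext i j
      rcases i with (i | i | i) <;> rcases j with (j | j | j) <;> rfl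
    have : Invertible A := hAu.invertible
    rw [← h1, h2, det_fromBlocks₁₁]
    congr 1
    have h3 : fromBlocks C 0 0 (n • Aᵀ) - fromRows Bᴴ 0 * ⅟A * fromCols B 0
        = fromBlocks (C - Bᴴ * A⁻¹ * B) 0 0 (n • Aᵀ) := by
      rw [invOf_eq_nonsing_inv]
      simp [fromRows_mul, sub_eq_add_neg]
      ext i j
      rcases i with (i | i) <;> rcases j with (j | j) <;> simp
    rw [h3, det_fromBlocks_zero₂₁, det_smul, det_transpose]
    simp
  -- the symplectic Gram determinant
  have E2 : ‖t‖ ^ 2 = ‖A.det‖ ^ 2 * ‖s‖ ^ 2 := by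
    obtain ⟨T', hT'⟩ : ∃ T', T' = fromRows R (fromRows S M) := ⟨_, rfl⟩
    have h2 : T * W * T'ᵀ = fromBlocks A 0 (fromRows (S * W * Rᵀ) (R * W * Rᵀ))
        (fromBlocks (S * W * Sᵀ) 0 (R * W * Sᵀ) (-Aᵀ)) := by
      rw [hT, hT']
      simp only [transpose_fromRows, fromRows_mul,
        mul_fromCols, hMWR, hMS, hMM, hSM, hRWM]
      ext i j
      rcases i with (i | i | i) <;> rcases j with (j | j | j) <;> rfl
    have h3 := congrArg det h2
    rw [det_fromBlocks_zero₁₂, det_fromBlocks_zero₁₂, hSS, hm_det_rect e, ← ht,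
      ← transpose_submatrix, det_transpose, det_neg, det_transpose] at h3
    obtain ⟨σ, hσ⟩ : ∃ σ : Equiv.Perm (Fin 5 ⊕ (Fin 2 ⊕ Fin 5)),
        T'.submatrix id e = (T.submatrix id e).submatrix σ id := by
      refine ⟨⟨fun i => match i with
          | .inl a => .inr (.inr a)
          | .inr (.inl a) => .inr (.inl a)
          | .inr (.inr a) => .inl a,
        fun i => match i with
          | .inl a => .inr (.inr a)
          | .inr (.inl a) => .inr (.inl a)
          | .inr (.inr a) => .inl a, ?_, ?_⟩, ?_⟩
      · rintro (a | a | a) <;> rfl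
      · rintro (a | a | a) <;> rfl
      · ext i j
        rw [hT, hT']
        rcases i with (a | a | a) <;> rfl
    have h4 : ‖(T'.submatrix id e).det‖ = ‖t‖ := by
      rw [hσ, det_permute, ← ht]
      rcases Int.units_eq_one_or (Equiv.Perm.sign σ) with h | h <;> simp [h]
    have h5 : ‖W.det‖ = 1 := by
      have h := congrArg (fun X => ‖det X‖) hWW
      simp only [det_mul, det_neg, norm_mul, norm_pow, norm_neg, norm_one, det_one, one_pow,
        mul_one] at h
      nlinarith [norm_nonneg W.det]
    have h6 := congrArg norm h3
    simp only [norm_mul, norm_pow, norm_neg, norm_one, one_pow, h4, h5] at h6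
    linear_combination h6
  have hdA : star A.det = A.det := by rw [← det_conjTranspose, hAH]
  have hd0 : A.det ≠ 0 := ((isUnit_iff_isUnit_det A).1 hAu).ne_zero
  have E3 : star t * t = A.det * A.det * (star s * s) := by
    have h (z : ℂ) : star z * z = ((‖z‖ ^ 2 : ℝ) : ℂ) := by
      have := Complex.conj_mul' z
      push_cast
      exact this
    have h7 := h A.det
    rw [hdA] at h7
    rw [h7, h t, h s, E2]
    push_cast
    ring
  have hne : A.det * A.det * n ^ 5 ≠ 0 := by positivity
  apply mul_left_cancel₀ hne
  linear_combination (-1 : ℂ) * E1 + n ^ 6 * E3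

theorem hm_schur (x : Fin 4 → ℂ) : (Cmat x - (Bmat x)ᴴ * (Amat x)⁻¹ * Bmat x).det =
    nC x * (star (x 0 * x 1 * x 2 * x 3) * (x 0 * x 1 * x 2 * x 3)) := by
  have e : Fin 5 ⊕ (Fin 2 ⊕ Fin 5) ≃ Fin 6 ⊕ Fin 6 := Fintype.equivOfCardEq (by simp)
  have hL := hm_L_sq
  have hdL : hmL.det * hmL.det = 1 := by rw [← det_mul, hL, det_one]
  have hHH : (hmL * (hmG x)ᵀ * hmL)ᴴ = hmL * (hmG x)ᵀ * hmL := by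
    have : (hmG x)ᵀᴴ = (hmG x)ᵀ := by
      ext i j
      exact congrFun (congrFun (hm_G_herm x) j) i
    simp only [conjTranspose_mul, hm_L_conjTranspose, this, Matrix.mul_assoc]
  refine hm_key e (fromCols (hmM1 x) (hmM2 x)) (fromCols (hmS1 x) (hmS2 x))
    (fromBlocks (hmG x) 0 0 (hmG x))
    (fromBlocks (hmL * (hmG x)ᵀ * hmL) 0 0 (hmL * (hmG x)ᵀ * hmL))
    (fromBlocks 0 hmL (-hmL) 0) _ _ _ _ _ (hm_nC x) (hm_A_unit x)
    ?_ ?_ ?_ ?_ ?_ ?_ ?_ ?_ ?_ ?_ ?_ ?_ ?_ ?_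
  · rw [← hm_A]
    simp [fromCols_mul_fromBlocks, conjTranspose_fromCols_eq_fromRows_conjTranspose, fromCols_mul_fromRows]
  · rw [← hm_B]
    simp [fromCols_mul_fromBlocks, conjTranspose_fromCols_eq_fromRows_conjTranspose, fromCols_mul_fromRows]
  · rw [← hm_C]
    simp [fromCols_mul_fromBlocks, conjTranspose_fromCols_eq_fromRows_conjTranspose, fromCols_mul_fromRows]
  · simp [fromBlocks_conjTranspose, hm_G_herm]
  · rw [fromBlocks_conjTranspose, hHH]; simp
  · simp [fromBlocks_multiply, hm_G_inv, ← fromBlocks_one, fromBlocks_smul]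
  · have h := congrArg det (hm_G_inv x)
    simp only [det_mul, det_transpose, det_smul, det_one, Fintype.card_fin] at h
    rw [det_fromBlocks_zero₂₁]
    linear_combination h - (hmG x).det * (hmG x).det * hdL
  · simp [fromBlocks_transpose, hm_L_transpose, fromBlocks_neg]
  · simp [fromBlocks_conjTranspose, hm_L_conjTranspose, fromBlocks_neg]
  · simp [fromBlocks_multiply, ← fromBlocks_one, fromBlocks_neg, hL]
  · have : hmL * (hmL * (hmG x)ᵀ * hmL) * hmL = (hmG x)ᵀ := by
      calc _ = (hmL * hmL) * (hmG x)ᵀ * (hmL * hmL) := by simp only [Matrix.mul_assoc]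
        _ = _ := by rw [hL]; simp
    simp [fromBlocks_multiply, fromBlocks_neg, this, fromBlocks_transpose]
  · rw [← hm_MM]
    simp [fromCols_mul_fromBlocks, transpose_fromCols, fromCols_mul_fromRows]
    abel
  · rw [← hm_MS]
    simp [fromCols_mul_fromBlocks, transpose_fromCols, fromCols_mul_fromRows]
    abel
  · have : fromCols (hmS1 x) (hmS2 x) * fromBlocks 0 hmL (-hmL) 0 * (fromCols (hmS1 x) (hmS2 x))ᵀ
        = hmS1 x * hmL * (hmS2 x)ᵀ - hmS2 x * hmL * (hmS1 x)ᵀ := by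
      simp [fromCols_mul_fromBlocks, transpose_fromCols, fromCols_mul_fromRows]
      abel
    rw [this, hm_SS, det_fin_two_of]
    ring

theorem horrocks_mumford_stmt10 (x : Fin 4 → ℂ) :
    IsUnit (Amat x) ∧
    (Hmat x).det =
      star (x 0) * x 0 * (star (x 1) * x 1) * (star (x 2) * x 2) * (star (x 3) * x 3)
        / nC x := by
  refine ⟨hm_A_unit x, ?_⟩
  have hn := hm_nC x
  rw [Hmat, det_smul, hm_schur]
  simp only [Fintype.card_fin, star_mul]
  field_simp
end
end

section
/- Let x¹ = (2,1,1,1) ∈ ℂ⁴. Then ν(x¹, conj x¹) ≠ 0, Â(x¹, conj x¹) and H(x¹) := Ĥ(x¹, conj x¹) are invertible, all partial derivatives ∂_α Ĥ, ∂̄_β Ĥ, ∂_α∂̄_β Ĥ (1 ≤ α,β ≤ 4) exist at (x¹, conj x¹), and the mean-curvature matrix satisfies K(x¹) = 2·I₂ (twice the 2×2 identity matrix). -/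
open Matrix

noncomputable section

/-- ν(x,y) = 1 + Σ x_i y_i, the polarization of n(x) = 1 + Σ |x_i|². -/
def nu (x y : Fin 4 → ℂ) : ℂ := 1 + ∑ i, x i * y i

/-- The pointwise conjugate vector, y = conj x. -/
def cconj (x : Fin 4 → ℂ) : Fin 4 → ℂ := fun i => star (x i)

/-- Â(x,y), the polarization of the 5×5 matrix A(x): every |x_i|² is replaced
by x_i·y_i and every conj(x_i) by y_i, so that Â(x, conj x) = A(x).
Here x 0,…,x 3 stand for x₁,…,x₄. -/
def Ahat (x y : Fin 4 → ℂ) : Matrix (Fin 5) (Fin 5) ℂ :=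
  !![nu x y + 1, y 1 * x 3, y 3 * x 2, y 0 * x 1, y 2 * x 0;
     y 3 * x 1, nu x y + x 0 * y 0, y 2, x 3, y 1 * x 2;
     y 2 * x 3, x 2, nu x y + x 1 * y 1, y 3 * x 0, y 0;
     y 1 * x 0, y 3, y 0 * x 3, nu x y + x 2 * y 2, x 1;
     y 0 * x 2, y 2 * x 1, x 0, y 1, nu x y + x 3 * y 3]

/-- B̂(x,y), the polarization of the 5×2 matrix B(x), with B̂(x, conj x) = B(x). -/
def Bhat (x y : Fin 4 → ℂ) : Matrix (Fin 5) (Fin 2) ℂ :=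
  !![(x 0 * y 0 + x 3 * y 3) * y 1 * y 2, -(x 1 * y 1 + x 2 * y 2) * y 0 * y 3;
     (1 + x 1 * y 1) * y 2 * y 3, -(x 2 * y 2 + x 3 * y 3) * y 1;
     (x 0 * y 0 + x 2 * y 2) * y 3, -(1 + x 3 * y 3) * y 0 * y 2;
     (x 1 * y 1 + x 3 * y 3) * y 0, -(1 + x 0 * y 0) * y 1 * y 3;
     (1 + x 2 * y 2) * y 0 * y 1, -(x 0 * y 0 + x 1 * y 1) * y 2]

/-- Ĉ(x,y) = diag(ĉ₁,ĉ₂), the polarization of C(x), with Ĉ(x, conj x) = C(x). -/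
def Chat (x y : Fin 4 → ℂ) : Matrix (Fin 2) (Fin 2) ℂ :=
  !![x 0 * y 0 * (x 1 * y 1) * (1 + x 2 * y 2) + x 0 * y 0 * (x 3 * y 3)
       + x 2 * y 2 * (x 3 * y 3) * (1 + x 1 * y 1), 0;
     0, x 0 * y 0 * (x 2 * y 2) * (1 + x 3 * y 3) + x 1 * y 1 * (x 2 * y 2)
       + x 1 * y 1 * (x 3 * y 3) * (1 + x 0 * y 0)]

/-- B̂*(x,y) := (B̂(y,x))ᵀ, so that B̂*(x, conj x) = conj(B(x))ᵀ. -/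
def BhatStar (x y : Fin 4 → ℂ) : Matrix (Fin 2) (Fin 5) ℂ := (Bhat y x)ᵀ

/-- Ĥ(x,y) = ν(x,y)⁻¹ · (Ĉ(x,y) − B̂*(x,y)·Â(x,y)⁻¹·B̂(x,y)); Ĥ(x, conj x) is the
matrix H(x) of the natural metric of E(−2) in the frame (ã₁,ã₂). -/
def Hhat (x y : Fin 4 → ℂ) : Matrix (Fin 2) (Fin 2) ℂ :=
  (nu x y)⁻¹ • (Chat x y - BhatStar x y * (Ahat x y)⁻¹ * Bhat x y)

/-- ∂_α Ĥ : the complex derivative of t ↦ Ĥ(x + t·e_α, y)_{ij} at t = 0. -/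
def dH (α : Fin 4) (x y : Fin 4 → ℂ) (i j : Fin 2) : ℂ :=
  deriv (fun t : ℂ => Hhat (x + t • (Pi.single α 1 : Fin 4 → ℂ)) y i j) 0

/-- ∂̄_β Ĥ : the complex derivative of s ↦ Ĥ(x, y + s·e_β)_{ij} at s = 0. -/
def dbH (β : Fin 4) (x y : Fin 4 → ℂ) (i j : Fin 2) : ℂ :=
  deriv (fun s : ℂ => Hhat x (y + s • (Pi.single β 1 : Fin 4 → ℂ)) i j) 0

/-- ∂_α ∂̄_β Ĥ : the mixed second derivative. -/
def ddH (α β : Fin 4) (x y : Fin 4 → ℂ) (i j : Fin 2) : ℂ :=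
  deriv (fun s : ℂ => dH α x (y + s • (Pi.single β 1 : Fin 4 → ℂ)) i j) 0

/-- g^{βα}(x) = n(x)·(δ_{αβ} + conj(x_β)·x_α), the inverse Fubini–Study
coefficients in the standard affine chart. -/
def gUp (x : Fin 4 → ℂ) (β α : Fin 4) : ℂ :=
  nu x (cconj x) * ((if α = β then 1 else 0) + star (x β) * x α)

/-- The mean-curvature matrix K(x) of the natural metric of E(−2) with respect
to the Fubini–Study metric:
K_{ij} = −Σ_{α,β} g^{βα}·( Σ_k ∂_α∂̄_β Ĥ_{ik}·(H⁻¹)_{kj}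
                           − Σ_{k,l,m} ∂_α Ĥ_{ik}·(H⁻¹)_{kl}·∂̄_β Ĥ_{lm}·(H⁻¹)_{mj} ),
all derivatives evaluated at (x, conj x) and H = Ĥ(x, conj x). -/
def Kmat (x : Fin 4 → ℂ) : Matrix (Fin 2) (Fin 2) ℂ :=
  Matrix.of fun i j =>
    -∑ α : Fin 4, ∑ β : Fin 4, gUp x β α *
      ((∑ k : Fin 2, ddH α β x (cconj x) i k * (Hhat x (cconj x))⁻¹ k j)
        - ∑ k : Fin 2, ∑ l : Fin 2, ∑ m : Fin 2,
            dH α x (cconj x) i k * (Hhat x (cconj x))⁻¹ k l *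
              dbH β x (cconj x) l m * (Hhat x (cconj x))⁻¹ m j)

/-! ### Generic versions over a commutative ring -/

def gNu {R : Type} [CommRing R] (x y : Fin 4 → R) : R := 1 + (x 0 * y 0 + x 1 * y 1 + x 2 * y 2 + x 3 * y 3)

def gA {R : Type} [CommRing R] (x y : Fin 4 → R) : Matrix (Fin 5) (Fin 5) R :=
  !![gNu x y + 1, y 1 * x 3, y 3 * x 2, y 0 * x 1, y 2 * x 0;
     y 3 * x 1, gNu x y + x 0 * y 0, y 2, x 3, y 1 * x 2;
     y 2 * x 3, x 2, gNu x y + x 1 * y 1, y 3 * x 0, y 0;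
     y 1 * x 0, y 3, y 0 * x 3, gNu x y + x 2 * y 2, x 1;
     y 0 * x 2, y 2 * x 1, x 0, y 1, gNu x y + x 3 * y 3]

def gB {R : Type} [CommRing R] (x y : Fin 4 → R) : Matrix (Fin 5) (Fin 2) R :=
  !![(x 0 * y 0 + x 3 * y 3) * y 1 * y 2, -(x 1 * y 1 + x 2 * y 2) * y 0 * y 3;
     (1 + x 1 * y 1) * y 2 * y 3, -(x 2 * y 2 + x 3 * y 3) * y 1;
     (x 0 * y 0 + x 2 * y 2) * y 3, -(1 + x 3 * y 3) * y 0 * y 2;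
     (x 1 * y 1 + x 3 * y 3) * y 0, -(1 + x 0 * y 0) * y 1 * y 3;
     (1 + x 2 * y 2) * y 0 * y 1, -(x 0 * y 0 + x 1 * y 1) * y 2]

def gC {R : Type} [CommRing R] (x y : Fin 4 → R) : Matrix (Fin 2) (Fin 2) R :=
  !![x 0 * y 0 * (x 1 * y 1) * (1 + x 2 * y 2) + x 0 * y 0 * (x 3 * y 3)
       + x 2 * y 2 * (x 3 * y 3) * (1 + x 1 * y 1), 0;
     0, x 0 * y 0 * (x 2 * y 2) * (1 + x 3 * y 3) + x 1 * y 1 * (x 2 * y 2)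
       + x 1 * y 1 * (x 3 * y 3) * (1 + x 0 * y 0)]

def gBs {R : Type} [CommRing R] (x y : Fin 4 → R) : Matrix (Fin 2) (Fin 5) R := (gB y x)ᵀ

theorem nu_eq (x y : Fin 4 → ℂ) : nu x y = gNu x y := by
  simp [nu, gNu, Fin.sum_univ_four]

theorem Ahat_eq (x y : Fin 4 → ℂ) : Ahat x y = gA x y := by
  simp only [Ahat, gA, nu_eq]

theorem Bhat_eq (x y : Fin 4 → ℂ) : Bhat x y = gB x y := rfl

theorem Chat_eq (x y : Fin 4 → ℂ) : Chat x y = gC x y := rfl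

theorem BhatStar_eq (x y : Fin 4 → ℂ) : BhatStar x y = gBs x y := rfl

/-- The `α`-th basis vector. -/
def bas {R : Type} [CommRing R] (α : Fin 4) : Fin 4 → R := Pi.single α 1

/-! ### Affine dependence on each coordinate -/

theorem gNu_x {R : Type} [CommRing R] (α : Fin 4) (x y : Fin 4 → R) (t : R) :
    gNu (x + t • bas α) y = gNu x y + t * (gNu (x + bas α) y - gNu x y) := by
  fin_cases α <;> simp [gNu, bas] <;> ring

theorem gNu_y {R : Type} [CommRing R] (β : Fin 4) (x y : Fin 4 → R) (t : R) :
    gNu x (y + t • bas β) = gNu x y + t * (gNu x (y + bas β) - gNu x y) := by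
  fin_cases β <;> simp [gNu, bas] <;> ring

set_option maxHeartbeats 4000000 in
theorem gA_x {R : Type} [CommRing R] (α : Fin 4) (x y : Fin 4 → R) (t : R) :
    gA (x + t • bas α) y = gA x y + t • (gA (x + bas α) y - gA x y) := by
  obtain ⟨e, he⟩ : ∃ e : Fin 4 → R, e = bas α := ⟨_, rfl⟩
  rw [← he]
  simp only [gA, gNu, Pi.add_apply, Pi.smul_apply, smul_eq_mul]
  ext i j
  fin_cases i <;> fin_cases j <;> simp <;> ring

set_option maxHeartbeats 4000000 in
theorem gA_y {R : Type} [CommRing R] (β : Fin 4) (x y : Fin 4 → R) (t : R) :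
    gA x (y + t • bas β) = gA x y + t • (gA x (y + bas β) - gA x y) := by
  obtain ⟨e, he⟩ : ∃ e : Fin 4 → R, e = bas β := ⟨_, rfl⟩
  rw [← he]
  simp only [gA, gNu, Pi.add_apply, Pi.smul_apply, smul_eq_mul]
  ext i j
  fin_cases i <;> fin_cases j <;> simp <;> ring

set_option maxHeartbeats 4000000 in
theorem gB_x {R : Type} [CommRing R] (α : Fin 4) (x y : Fin 4 → R) (t : R) :
    gB (x + t • bas α) y = gB x y + t • (gB (x + bas α) y - gB x y) := by
  obtain ⟨e, he⟩ : ∃ e : Fin 4 → R, e = bas α := ⟨_, rfl⟩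
  rw [← he]
  simp only [gB, Pi.add_apply, Pi.smul_apply, smul_eq_mul]
  ext i j
  fin_cases i <;> fin_cases j <;> simp <;> ring

set_option maxHeartbeats 4000000 in
theorem gB_y {R : Type} [CommRing R] (β : Fin 4) (x y : Fin 4 → R) (t : R) :
    gB x (y + t • bas β) = gB x y + t • (gB x (y + bas β) - gB x y) := by
  ext i j
  fin_cases β <;> fin_cases i <;> fin_cases j <;>
    simp [gB, bas] <;> ring

theorem gBs_x {R : Type} [CommRing R] (α : Fin 4) (x y : Fin 4 → R) (t : R) :
    gBs (x + t • bas α) y = gBs x y + t • (gBs (x + bas α) y - gBs x y) := by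
  unfold gBs
  rw [gB_y]; ext i j; simp

theorem gBs_y {R : Type} [CommRing R] (β : Fin 4) (x y : Fin 4 → R) (t : R) :
    gBs x (y + t • bas β) = gBs x y + t • (gBs x (y + bas β) - gBs x y) := by
  unfold gBs
  rw [gB_x]; ext i j; simp

theorem gC_x {R : Type} [CommRing R] (α : Fin 4) (x y : Fin 4 → R) (t : R) :
    gC (x + t • bas α) y = gC x y + t • (gC (x + bas α) y - gC x y) := by
  ext i j
  fin_cases α <;> fin_cases i <;> fin_cases j <;>
    simp [gC, bas] <;> ring

theorem gC_y {R : Type} [CommRing R] (β : Fin 4) (x y : Fin 4 → R) (t : R) :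
    gC x (y + t • bas β) = gC x y + t • (gC x (y + bas β) - gC x y) := by
  ext i j
  fin_cases β <;> fin_cases i <;> fin_cases j <;>
    simp [gC, bas] <;> ring

/-! ### Compatibility with the cast from the rationals -/

def cvec (x : Fin 4 → ℚ) : Fin 4 → ℂ := fun i => (x i : ℂ)

def cm {m n : Type} (M : Matrix m n ℚ) : Matrix m n ℂ := M.map (Rat.castHom ℂ)

theorem cvec_bas (x : Fin 4 → ℚ) (α : Fin 4) : cvec x + bas α = cvec (x + bas α) := by
  funext i
  by_cases h : i = α <;> simp [cvec, bas, h]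

theorem gNu_cast (x y : Fin 4 → ℚ) : gNu (cvec x) (cvec y) = ((gNu x y : ℚ) : ℂ) := by
  simp [gNu, cvec]

theorem gA_cast (x y : Fin 4 → ℚ) : gA (cvec x) (cvec y) = cm (gA x y) := by
  ext i j
  fin_cases i <;> fin_cases j <;> simp [gA, gNu, cvec, cm]

theorem gB_cast (x y : Fin 4 → ℚ) : gB (cvec x) (cvec y) = cm (gB x y) := by
  ext i j
  fin_cases i <;> fin_cases j <;> simp [gB, cvec, cm]

theorem gBs_cast (x y : Fin 4 → ℚ) : gBs (cvec x) (cvec y) = cm (gBs x y) := by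
  unfold gBs; rw [gB_cast]; rfl

theorem gC_cast (x y : Fin 4 → ℚ) : gC (cvec x) (cvec y) = cm (gC x y) := by
  ext i j
  fin_cases i <;> fin_cases j <;> simp [gC, cvec, cm]

theorem cm_mul {l m n : Type} [Fintype m] (M : Matrix l m ℚ) (N : Matrix m n ℚ) :
    cm (M * N) = cm M * cm N := Matrix.map_mul

theorem cm_sub {m n : Type} (M N : Matrix m n ℚ) : cm (M - N) = cm M - cm N := by
  ext i j; simp [cm]

theorem cm_add {m n : Type} (M N : Matrix m n ℚ) : cm (M + N) = cm M + cm N := by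
  ext i j; simp [cm]

theorem cm_smul {m n : Type} (c : ℚ) (M : Matrix m n ℚ) : cm (c • M) = (c : ℂ) • cm M := by
  ext i j; simp [cm]

theorem cm_one {m : Type} [DecidableEq m] : cm (1 : Matrix m m ℚ) = 1 := by
  unfold cm; exact Matrix.map_one _ (map_zero _) (map_one _)

/-! ### Entrywise derivatives of matrix-valued curves -/

def MD {m n : Type} (f : ℂ → Matrix m n ℂ) (f' : Matrix m n ℂ) (s : ℂ) : Prop :=
  ∀ i j, HasDerivAt (fun s => f s i j) (f' i j) s

theorem MD.congr {m n : Type} {f : ℂ → Matrix m n ℂ} {a b : Matrix m n ℂ} {s : ℂ}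
    (hf : MD f a s) (h : a = b) : MD f b s := h ▸ hf

theorem MD.add {m n : Type} {f g : ℂ → Matrix m n ℂ} {f' g' : Matrix m n ℂ} {s : ℂ}
    (hf : MD f f' s) (hg : MD g g' s) : MD (fun s => f s + g s) (f' + g') s :=
  fun i j => (hf i j).add (hg i j)

theorem MD.sub {m n : Type} {f g : ℂ → Matrix m n ℂ} {f' g' : Matrix m n ℂ} {s : ℂ}
    (hf : MD f f' s) (hg : MD g g' s) : MD (fun s => f s - g s) (f' - g') s :=
  fun i j => (hf i j).sub (hg i j)

theorem MD.smul {m n : Type} {c : ℂ → ℂ} {c' : ℂ} {g : ℂ → Matrix m n ℂ} {g' : Matrix m n ℂ}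
    {s : ℂ} (hc : HasDerivAt c c' s) (hg : MD g g' s) :
    MD (fun s => c s • g s) (c' • g s + c s • g') s :=
  fun i j => hc.mul (hg i j)

theorem MD.mul {l m n : Type} [Fintype m] {f : ℂ → Matrix l m ℂ} {g : ℂ → Matrix m n ℂ}
    {f' : Matrix l m ℂ} {g' : Matrix m n ℂ} {s : ℂ}
    (hf : MD f f' s) (hg : MD g g' s) : MD (fun s => f s * g s) (f' * g s + f s * g') s := by
  intro i j
  have := HasDerivAt.fun_sum (u := Finset.univ)
    (fun k _ => (hf i k).mul (hg k j))
  simpa [Matrix.mul_apply, Finset.sum_add_distrib] using this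

theorem MD.line {m n : Type} {f : ℂ → Matrix m n ℂ} {a b : Matrix m n ℂ}
    (h : ∀ t, f t = a + t • b) : MD f b 0 := by
  intro i j
  have h2 : (fun t => f t i j) = fun t => a i j + t * b i j := by
    funext t; simp [h t]
  rw [h2]
  simpa using ((hasDerivAt_id (0 : ℂ)).mul_const (b i j)).const_add (a i j)

theorem deriv_line {f : ℂ → ℂ} {a b : ℂ} (h : ∀ t, f t = a + t * b) : HasDerivAt f b 0 := by
  have h2 : f = fun t => a + t * b := funext h
  rw [h2]
  simpa using ((hasDerivAt_id (0 : ℂ)).mul_const b).const_add a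

theorem det_diff {m : Type} [Fintype m] [DecidableEq m] {f : ℂ → Matrix m m ℂ} {s : ℂ}
    (hf : ∀ i j, DifferentiableAt ℂ (fun s => f s i j) s) :
    DifferentiableAt ℂ (fun s => (f s).det) s := by
  simp only [Matrix.det_apply']
  fun_prop

theorem MD.inv {m : Type} [Fintype m] [DecidableEq m] {f : ℂ → Matrix m m ℂ} {f' : Matrix m m ℂ}
    {s : ℂ} (hf : MD f f' s) (h0 : (f s).det ≠ 0) :
    MD (fun s => (f s)⁻¹) (-((f s)⁻¹ * f' * (f s)⁻¹)) s := by
  have hd := det_diff (fun i j => (hf i j).differentiableAt)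
  have hD : ∀ i j, DifferentiableAt ℂ (fun s => (f s)⁻¹ i j) s := by
    intro i j
    simp only [Matrix.inv_def, Ring.inverse_eq_inv', Matrix.smul_apply, smul_eq_mul,
      Matrix.adjugate_apply]
    refine (hd.inv h0).mul (det_diff fun k l => ?_)
    by_cases hk : k = j
    · subst hk; simp
    · simpa [Matrix.updateRow_ne hk] using (hf k l).differentiableAt
  let D : Matrix m m ℂ := Matrix.of fun i j => deriv (fun s => (f s)⁻¹ i j) s
  have h1 : MD (fun s => (f s)⁻¹) D s := fun i j => (hD i j).hasDerivAt
  have h2 := hf.mul h1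
  have hev : ∀ᶠ t in nhds s, (f t).det ≠ 0 := hd.continuousAt.eventually_ne h0
  have h3 : f' * (f s)⁻¹ + f s * D = 0 := by
    ext i j
    refine (h2 i j).unique ?_
    refine (hasDerivAt_const s ((1 : Matrix m m ℂ) i j)).congr_of_eventuallyEq ?_
    filter_upwards [hev] with t ht
    rw [Matrix.mul_nonsing_inv _ (isUnit_iff_ne_zero.mpr ht)]
  have h4 : D = -((f s)⁻¹ * f' * (f s)⁻¹) := by
    have h5 : (f s)⁻¹ * (f' * (f s)⁻¹ + f s * D) = 0 := by rw [h3, Matrix.mul_zero]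
    rw [Matrix.mul_add, ← Matrix.mul_assoc, ← Matrix.mul_assoc,
      Matrix.nonsing_inv_mul _ (isUnit_iff_ne_zero.mpr h0), Matrix.one_mul] at h5
    exact eq_neg_of_add_eq_zero_right h5
  rw [← h4]; exact h1

/-! ### First and second derivative formulas -/

/-- The first derivative of `C - B* A⁻¹ B` with `X = A⁻¹ B`, `Y = B* A⁻¹`. -/
def S1 {R : Type} [CommRing R] (X : Matrix (Fin 5) (Fin 2) R) (Y : Matrix (Fin 2) (Fin 5) R)
    (A' : Matrix (Fin 5) (Fin 5) R) (B' : Matrix (Fin 5) (Fin 2) R)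
    (E' : Matrix (Fin 2) (Fin 5) R) (C' : Matrix (Fin 2) (Fin 2) R) : Matrix (Fin 2) (Fin 2) R :=
  C' - E' * X - Y * (B' - A' * X)

def D1 {R : Type} [Field R] (v v' : R) (S S' : Matrix (Fin 2) (Fin 2) R) :
    Matrix (Fin 2) (Fin 2) R :=
  v⁻¹ • S' - (v' * (v⁻¹ * v⁻¹)) • S

def S2 {R : Type} [CommRing R] (P : Matrix (Fin 5) (Fin 5) R)
    (X : Matrix (Fin 5) (Fin 2) R) (Y : Matrix (Fin 2) (Fin 5) R)
    (Aa Ab Aab : Matrix (Fin 5) (Fin 5) R) (Ba Bb Bab : Matrix (Fin 5) (Fin 2) R)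
    (Ea Eb Eab : Matrix (Fin 2) (Fin 5) R) (Cab : Matrix (Fin 2) (Fin 2) R) :
    Matrix (Fin 2) (Fin 2) R :=
  S1 X Y Aab Bab Eab Cab - (Ea - Y * Aa) * P * (Bb - Ab * X) - (Eb - Y * Ab) * P * (Ba - Aa * X)

def D2 {R : Type} [Field R] (v va vb vab : R) (S Sa Sb Sab : Matrix (Fin 2) (Fin 2) R) :
    Matrix (Fin 2) (Fin 2) R :=
  v⁻¹ • Sab - (vb * (v⁻¹ * v⁻¹)) • Sa - (va * (v⁻¹ * v⁻¹)) • Sb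
    - ((vab - 2 * va * vb * v⁻¹) * (v⁻¹ * v⁻¹)) • S

theorem inv_deriv {v : ℂ → ℂ} {v' s : ℂ} (hv : HasDerivAt v v' s) (h0 : v s ≠ 0) :
    HasDerivAt (fun s => (v s)⁻¹) (-(v' * ((v s)⁻¹ * (v s)⁻¹))) s := by
  have h := hv.inv h0
  rw [neg_div, div_eq_mul_inv, sq, mul_inv] at h
  exact h

theorem S1_MD {A : ℂ → Matrix (Fin 5) (Fin 5) ℂ} {B : ℂ → Matrix (Fin 5) (Fin 2) ℂ}
    {E : ℂ → Matrix (Fin 2) (Fin 5) ℂ} {C : ℂ → Matrix (Fin 2) (Fin 2) ℂ}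
    {A' : Matrix (Fin 5) (Fin 5) ℂ} {B' : Matrix (Fin 5) (Fin 2) ℂ}
    {E' : Matrix (Fin 2) (Fin 5) ℂ} {C' : Matrix (Fin 2) (Fin 2) ℂ} {s : ℂ}
    (hA : MD A A' s) (hB : MD B B' s) (hE : MD E E' s) (hC : MD C C' s) (h0 : (A s).det ≠ 0) :
    MD (fun s => C s - E s * (A s)⁻¹ * B s)
      (S1 ((A s)⁻¹ * B s) (E s * (A s)⁻¹) A' B' E' C') s := by
  have h := hC.sub ((hE.mul (hA.inv h0)).mul hB)
  refine MD.congr h ?_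
  simp only [S1, Matrix.mul_add, Matrix.add_mul, Matrix.mul_sub, Matrix.sub_mul, Matrix.mul_neg,
    Matrix.neg_mul, Matrix.mul_assoc]
  abel

theorem D1_MD {v : ℂ → ℂ} {v' s : ℂ} {S : ℂ → Matrix (Fin 2) (Fin 2) ℂ}
    {S' : Matrix (Fin 2) (Fin 2) ℂ} (hv : HasDerivAt v v' s) (h0 : v s ≠ 0) (hS : MD S S' s) :
    MD (fun s => (v s)⁻¹ • S s) (D1 (v s) v' (S s) S') s := by
  refine MD.congr (MD.smul (inv_deriv hv h0) hS) ?_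
  rw [D1, neg_smul]; abel

theorem S2_MD {A Aa : ℂ → Matrix (Fin 5) (Fin 5) ℂ} {B Ba : ℂ → Matrix (Fin 5) (Fin 2) ℂ}
    {E Ea : ℂ → Matrix (Fin 2) (Fin 5) ℂ} {Ca : ℂ → Matrix (Fin 2) (Fin 2) ℂ}
    {Ab Aab : Matrix (Fin 5) (Fin 5) ℂ} {Bb Bab : Matrix (Fin 5) (Fin 2) ℂ}
    {Eb Eab : Matrix (Fin 2) (Fin 5) ℂ} {Cab : Matrix (Fin 2) (Fin 2) ℂ} {s : ℂ}
    (hA : MD A Ab s) (hB : MD B Bb s) (hE : MD E Eb s)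
    (hAa : MD Aa Aab s) (hBa : MD Ba Bab s) (hEa : MD Ea Eab s) (hCa : MD Ca Cab s)
    (h0 : (A s).det ≠ 0) :
    MD (fun s => S1 ((A s)⁻¹ * B s) (E s * (A s)⁻¹) (Aa s) (Ba s) (Ea s) (Ca s))
      (S2 (A s)⁻¹ ((A s)⁻¹ * B s) (E s * (A s)⁻¹) (Aa s) Ab Aab (Ba s) Bb Bab (Ea s) Eb Eab Cab)
      s := by
  have hP := hA.inv h0
  have hX := hP.mul hB
  have hY := hE.mul hP
  have h := (hCa.sub (hEa.mul hX)).sub (hY.mul (hBa.sub (hAa.mul hX)))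
  refine MD.congr h ?_
  simp only [S1, S2, Matrix.mul_add, Matrix.add_mul, Matrix.mul_sub, Matrix.sub_mul,
    Matrix.mul_neg, Matrix.neg_mul, Matrix.mul_assoc]
  abel

theorem D2_MD {v va : ℂ → ℂ} {vb vab s : ℂ} {S Sa : ℂ → Matrix (Fin 2) (Fin 2) ℂ}
    {Sb Sab : Matrix (Fin 2) (Fin 2) ℂ} (hv : HasDerivAt v vb s) (hva : HasDerivAt va vab s)
    (h0 : v s ≠ 0) (hS : MD S Sb s) (hSa : MD Sa Sab s) :
    MD (fun s => D1 (v s) (va s) (S s) (Sa s)) (D2 (v s) (va s) vb vab (S s) (Sa s) Sb Sab) s := by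
  have hi := inv_deriv hv h0
  refine MD.congr ((MD.smul hi hSa).sub (MD.smul (hva.mul (hi.mul hi)) hS)) ?_
  ext i j
  simp [D2]
  ring

/-! ### The derivatives of `Hhat` -/

def hS (x y : Fin 4 → ℂ) : Matrix (Fin 2) (Fin 2) ℂ := gC x y - gBs x y * (gA x y)⁻¹ * gB x y

theorem Hhat_eq (x y : Fin 4 → ℂ) : Hhat x y = (gNu x y)⁻¹ • hS x y := by
  simp only [Hhat, hS, nu_eq, Ahat_eq, Bhat_eq, Chat_eq, BhatStar_eq]

/-- First derivative of `hS` in the `x`-direction `α`. -/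
def hSx (α : Fin 4) (x y : Fin 4 → ℂ) : Matrix (Fin 2) (Fin 2) ℂ :=
  S1 ((gA x y)⁻¹ * gB x y) (gBs x y * (gA x y)⁻¹) (gA (x + bas α) y - gA x y)
    (gB (x + bas α) y - gB x y) (gBs (x + bas α) y - gBs x y) (gC (x + bas α) y - gC x y)

/-- First derivative of `hS` in the `y`-direction `β`. -/
def hSy (β : Fin 4) (x y : Fin 4 → ℂ) : Matrix (Fin 2) (Fin 2) ℂ :=
  S1 ((gA x y)⁻¹ * gB x y) (gBs x y * (gA x y)⁻¹) (gA x (y + bas β) - gA x y)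
    (gB x (y + bas β) - gB x y) (gBs x (y + bas β) - gBs x y) (gC x (y + bas β) - gC x y)

/-- Mixed second difference. -/
def mixd {R M : Type} [CommRing R] [AddCommGroup M] (f : (Fin 4 → R) → (Fin 4 → R) → M)
    (α β : Fin 4) (x y : Fin 4 → R) : M :=
  (f (x + bas α) (y + bas β) - f (x + bas α) y) - (f x (y + bas β) - f x y)

def hSxy (α β : Fin 4) (x y : Fin 4 → ℂ) : Matrix (Fin 2) (Fin 2) ℂ :=
  S2 (gA x y)⁻¹ ((gA x y)⁻¹ * gB x y) (gBs x y * (gA x y)⁻¹)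
    (gA (x + bas α) y - gA x y) (gA x (y + bas β) - gA x y) (mixd gA α β x y)
    (gB (x + bas α) y - gB x y) (gB x (y + bas β) - gB x y) (mixd gB α β x y)
    (gBs (x + bas α) y - gBs x y) (gBs x (y + bas β) - gBs x y) (mixd gBs α β x y)
    (mixd gC α β x y)

theorem hS_x (α : Fin 4) (x y : Fin 4 → ℂ) (h : (gA x y).det ≠ 0) :
    MD (fun t => hS (x + t • bas α) y) (hSx α x y) 0 := by
  have := S1_MD (MD.line (gA_x α x y)) (MD.line (gB_x α x y)) (MD.line (gBs_x α x y))
    (MD.line (gC_x α x y)) (by simpa using h)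
  simp only [zero_smul, add_zero] at this
  exact this

theorem hS_y (β : Fin 4) (x y : Fin 4 → ℂ) (h : (gA x y).det ≠ 0) :
    MD (fun t => hS x (y + t • bas β)) (hSy β x y) 0 := by
  have := S1_MD (MD.line (gA_y β x y)) (MD.line (gB_y β x y)) (MD.line (gBs_y β x y))
    (MD.line (gC_y β x y)) (by simpa using h)
  simp only [zero_smul, add_zero] at this
  exact this

theorem Hhat_x (α : Fin 4) (x y : Fin 4 → ℂ) (hn : gNu x y ≠ 0) (h : (gA x y).det ≠ 0) :
    MD (fun t => Hhat (x + t • bas α) y)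
      (D1 (gNu x y) (gNu (x + bas α) y - gNu x y) (hS x y) (hSx α x y)) 0 := by
  have := D1_MD (deriv_line (gNu_x α x y)) (by simpa using hn) (hS_x α x y h)
  simpa only [zero_smul, add_zero, ← Hhat_eq] using this

theorem Hhat_y (β : Fin 4) (x y : Fin 4 → ℂ) (hn : gNu x y ≠ 0) (h : (gA x y).det ≠ 0) :
    MD (fun t => Hhat x (y + t • bas β))
      (D1 (gNu x y) (gNu x (y + bas β) - gNu x y) (hS x y) (hSy β x y)) 0 := by
  have := D1_MD (deriv_line (gNu_y β x y)) (by simpa using hn) (hS_y β x y h)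
  simpa only [zero_smul, add_zero, ← Hhat_eq] using this

theorem dH_eq (α : Fin 4) (x y : Fin 4 → ℂ) (hn : gNu x y ≠ 0) (h : (gA x y).det ≠ 0) (i j : Fin 2) :
    dH α x y i j = D1 (gNu x y) (gNu (x + bas α) y - gNu x y) (hS x y) (hSx α x y) i j :=
  (Hhat_x α x y hn h i j).deriv

theorem dbH_eq (β : Fin 4) (x y : Fin 4 → ℂ) (hn : gNu x y ≠ 0) (h : (gA x y).det ≠ 0)
    (i j : Fin 2) :
    dbH β x y i j = D1 (gNu x y) (gNu x (y + bas β) - gNu x y) (hS x y) (hSy β x y) i j :=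
  (Hhat_y β x y hn h i j).deriv

theorem MD.line_diff {m n : Type} {f g : ℂ → Matrix m n ℂ} {a b c d : Matrix m n ℂ}
    (hf : ∀ t, f t = a + t • b) (hg : ∀ t, g t = c + t • d) :
    MD (fun t => f t - g t) (b - d) 0 := (MD.line hf).sub (MD.line hg)

theorem dH_y (α β : Fin 4) (x y : Fin 4 → ℂ) (hn : gNu x y ≠ 0) (h : (gA x y).det ≠ 0) :
    MD (fun s => Matrix.of (dH α x (y + s • bas β)))
      (D2 (gNu x y) (gNu (x + bas α) y - gNu x y) (gNu x (y + bas β) - gNu x y)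
        (mixd gNu α β x y) (hS x y) (hSx α x y) (hSy β x y) (hSxy α β x y)) 0 := by
  have hSa := S2_MD (MD.line (gA_y β x y)) (MD.line (gB_y β x y)) (MD.line (gBs_y β x y))
    (MD.line_diff (gA_y β (x + bas α) y) (gA_y β x y))
    (MD.line_diff (gB_y β (x + bas α) y) (gB_y β x y))
    (MD.line_diff (gBs_y β (x + bas α) y) (gBs_y β x y))
    (MD.line_diff (gC_y β (x + bas α) y) (gC_y β x y)) (by simpa using h)
  have hD := D2_MD (deriv_line (gNu_y β x y))
    ((deriv_line (gNu_y β (x + bas α) y)).sub (deriv_line (gNu_y β x y)))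
    (by simpa using hn) (hS_y β x y h) hSa
  have hc1 : ∀ᶠ s in nhds (0 : ℂ), gNu x (y + s • bas β) ≠ 0 :=
    (deriv_line (gNu_y β x y)).continuousAt.eventually_ne (by simpa using hn)
  have hc2 : ∀ᶠ s in nhds (0 : ℂ), (gA x (y + s • bas β)).det ≠ 0 :=
    (det_diff fun i j => ((MD.line (gA_y β x y)) i j).differentiableAt).continuousAt.eventually_ne
      (by simpa using h)
  intro i j
  have hij := hD i j
  simp only [zero_smul, add_zero, Pi.sub_apply] at hij
  refine HasDerivAt.congr_of_eventuallyEq hij ?_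
  filter_upwards [hc1, hc2] with s h1 h2
  exact dH_eq α x _ h1 h2 i j

theorem ddH_eq (α β : Fin 4) (x y : Fin 4 → ℂ) (hn : gNu x y ≠ 0) (h : (gA x y).det ≠ 0)
    (i j : Fin 2) :
    ddH α β x y i j = D2 (gNu x y) (gNu (x + bas α) y - gNu x y) (gNu x (y + bas β) - gNu x y)
        (mixd gNu α β x y) (hS x y) (hSx α x y) (hSy β x y) (hSxy α β x y) i j :=
  (dH_y α β x y hn h i j).deriv

/-! ### Numerical data at the point `(2,1,1,1)`, over the rationals -/

def qx : Fin 4 → ℚ := ![2, 1, 1, 1]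

def qP : Matrix (Fin 5) (Fin 5) ℚ :=
  !![241/1968, -1/164, -5/1968, -23/984, -23/984;
     -1/164, 7/82, -1/164, -1/164, -1/164;
     -5/1968, -1/164, 241/1968, -23/984, -23/984;
     -23/984, -1/164, -23/984, 241/1968, -5/1968;
     -23/984, -1/164, -23/984, -5/1968, 241/1968]

def qX : Matrix (Fin 5) (Fin 2) ℚ :=
  !![197/492, -115/492; 5/82, -5/82; 197/492, -115/492; 115/492, -197/492; 115/492, -197/492]

def qY : Matrix (Fin 2) (Fin 5) ℚ :=
  !![197/492, 5/82, 197/492, 115/492, 115/492; -115/492, -5/82, -115/492, -197/492, -197/492]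

def qS : Matrix (Fin 2) (Fin 2) ℚ :=
  !![1969/246, 1393/246; 1393/246, 1969/246]

def qHi : Matrix (Fin 2) (Fin 2) ℚ :=
  !![1969/984, -1393/984; -1393/984, 1969/984]

def qHx : Fin 4 → Matrix (Fin 2) (Fin 2) ℚ :=
  ![!![134327/968256, 104375/968256; 104375/968256, 134327/968256],
    !![1181281/1936512, 736945/1936512; 425017/1936512, 487561/1936512],
    !![487561/1936512, 425017/1936512; 736945/1936512, 1181281/1936512],
    !![487561/1936512, 425017/1936512; 736945/1936512, 1181281/1936512]]

def qHy : Fin 4 → Matrix (Fin 2) (Fin 2) ℚ :=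
  ![!![134327/968256, 104375/968256; 104375/968256, 134327/968256],
    !![1181281/1936512, 425017/1936512; 736945/1936512, 487561/1936512],
    !![487561/1936512, 736945/1936512; 425017/1936512, 1181281/1936512],
    !![487561/1936512, 736945/1936512; 425017/1936512, 1181281/1936512]]

def qHxy : Fin 4 → Fin 4 → Matrix (Fin 2) (Fin 2) ℚ :=
  ![![!![-9384163/119095488, -11981347/119095488; -11981347/119095488, -9384163/119095488],
     !![45741241/238190976, 32862811/238190976; 16776133/238190976, 6071527/238190976],
     !![6071527/238190976, 16776133/238190976; 32862811/238190976, 45741241/238190976],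
     !![6071527/238190976, 16776133/238190976; 32862811/238190976, 45741241/238190976]],
    ![!![45741241/238190976, 16776133/238190976; 32862811/238190976, 6071527/238190976],
     !![136627907/476381952, 51884681/476381952; 51884681/476381952, 38655455/476381952],
     !![156422665/952763904, 170628349/952763904; -47186939/952763904, 47251801/952763904],
     !![47251801/952763904, 170628349/952763904; -47186939/952763904, 156422665/952763904]],
    ![!![6071527/238190976, 32862811/238190976; 16776133/238190976, 45741241/238190976],
     !![156422665/952763904, -47186939/952763904; 170628349/952763904, 47251801/952763904],
     !![38655455/476381952, 51884681/476381952; 51884681/476381952, 136627907/476381952],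
     !![2346913/14886936, 36479689/238190976; 36479689/238190976, 39940037/119095488]],
    ![!![6071527/238190976, 32862811/238190976; 16776133/238190976, 45741241/238190976],
     !![47251801/952763904, -47186939/952763904; 170628349/952763904, 156422665/952763904],
     !![2346913/14886936, 36479689/238190976; 36479689/238190976, 39940037/119095488],
     !![38655455/476381952, 51884681/476381952; 51884681/476381952, 136627907/476381952]]]

def qSx (α : Fin 4) : Matrix (Fin 2) (Fin 2) ℚ :=
  S1 qX qY (gA (qx + bas α) qx - gA qx qx) (gB (qx + bas α) qx - gB qx qx)
    (gBs (qx + bas α) qx - gBs qx qx) (gC (qx + bas α) qx - gC qx qx)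

def qSy (β : Fin 4) : Matrix (Fin 2) (Fin 2) ℚ :=
  S1 qX qY (gA qx (qx + bas β) - gA qx qx) (gB qx (qx + bas β) - gB qx qx)
    (gBs qx (qx + bas β) - gBs qx qx) (gC qx (qx + bas β) - gC qx qx)

def qSxy (α β : Fin 4) : Matrix (Fin 2) (Fin 2) ℚ :=
  S2 qP qX qY
    (gA (qx + bas α) qx - gA qx qx) (gA qx (qx + bas β) - gA qx qx) (mixd gA α β qx qx)
    (gB (qx + bas α) qx - gB qx qx) (gB qx (qx + bas β) - gB qx qx) (mixd gB α β qx qx)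
    (gBs (qx + bas α) qx - gBs qx qx) (gBs qx (qx + bas β) - gBs qx qx) (mixd gBs α β qx qx)
    (mixd gC α β qx qx)

theorem qnu_val : gNu qx qx = 8 := by decide +kernel

theorem qP_val : gA qx qx * qP = 1 := by decide +kernel

theorem qX_val : qP * gB qx qx = qX := by decide +kernel

theorem qY_val : gBs qx qx * qP = qY := by decide +kernel

theorem qS_val : gC qx qx - qY * gB qx qx = qS := by decide +kernel

theorem qHi_val : ((gNu qx qx)⁻¹ • qS) * qHi = 1 := by decide +kernel

theorem qHx_val : ∀ α, D1 (gNu qx qx) (gNu (qx + bas α) qx - gNu qx qx) qS (qSx α) = qHx α := by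
  decide +kernel

theorem qHy_val : ∀ β, D1 (gNu qx qx) (gNu qx (qx + bas β) - gNu qx qx) qS (qSy β) = qHy β := by
  decide +kernel

theorem qHxy_val : ∀ α β, D2 (gNu qx qx) (gNu (qx + bas α) qx - gNu qx qx)
    (gNu qx (qx + bas β) - gNu qx qx) (mixd gNu α β qx qx) qS (qSx α) (qSy β) (qSxy α β)
      = qHxy α β := by
  decide +kernel

theorem qK_val : ∀ i j : Fin 2,
    -∑ α : Fin 4, ∑ β : Fin 4, (gNu qx qx * ((if α = β then 1 else 0) + qx β * qx α)) *
      ((∑ k : Fin 2, qHxy α β i k * qHi k j)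
        - ∑ k : Fin 2, ∑ l : Fin 2, ∑ m : Fin 2, qHx α i k * qHi k l * qHy β l m * qHi m j)
      = if i = j then 2 else 0 := by
  decide +kernel

/-! ### Transfer to the complex numbers -/

theorem cvec_qx : cvec qx = ![2, 1, 1, 1] := by
  funext i; fin_cases i <;> simp [cvec, qx]

theorem cconj_qx : cconj (cvec qx) = cvec qx := by
  funext i; fin_cases i <;> simp [cconj, cvec, qx]

theorem nu_ne : gNu (cvec qx) (cvec qx) ≠ 0 := by
  rw [gNu_cast, qnu_val]; norm_num

theorem A_mul : gA (cvec qx) (cvec qx) * cm qP = 1 := by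
  rw [gA_cast, ← cm_mul, qP_val, cm_one]

theorem A_inv : (gA (cvec qx) (cvec qx))⁻¹ = cm qP := Matrix.inv_eq_right_inv A_mul

theorem A_det : (gA (cvec qx) (cvec qx)).det ≠ 0 :=
  (Matrix.isUnit_det_of_right_inverse A_mul).ne_zero

theorem hS_val : hS (cvec qx) (cvec qx) = cm qS := by
  rw [hS, A_inv, gC_cast, gBs_cast, gB_cast, ← cm_mul, qY_val, ← cm_mul, ← cm_sub, qS_val]

theorem H_mul : Hhat (cvec qx) (cvec qx) * cm qHi = 1 := by
  rw [Hhat_eq, hS_val, gNu_cast, ← Rat.cast_inv, ← cm_smul, ← cm_mul, qHi_val, cm_one]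

theorem H_inv : (Hhat (cvec qx) (cvec qx))⁻¹ = cm qHi := Matrix.inv_eq_right_inv H_mul

theorem cm_S1 (X Y A' B' E' C') : cm (S1 X Y A' B' E' C') =
    S1 (cm X) (cm Y) (cm A') (cm B') (cm E') (cm C') := by
  simp only [S1, cm_sub, cm_mul]

theorem cm_S2 (P X Y Aa Ab Aab Ba Bb Bab Ea Eb Eab Cab) :
    cm (S2 P X Y Aa Ab Aab Ba Bb Bab Ea Eb Eab Cab) =
    S2 (cm P) (cm X) (cm Y) (cm Aa) (cm Ab) (cm Aab) (cm Ba) (cm Bb) (cm Bab) (cm Ea) (cm Eb)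
      (cm Eab) (cm Cab) := by
  simp only [S2, cm_S1, cm_sub, cm_mul]

theorem cm_D1 (v v' : ℚ) (S S') : cm (D1 v v' S S') = D1 (v : ℂ) (v' : ℂ) (cm S) (cm S') := by
  simp only [D1, cm_sub, cm_smul]; push_cast; rfl

theorem cm_D2 (v va vb vab : ℚ) (S Sa Sb Sab) : cm (D2 v va vb vab S Sa Sb Sab) =
    D2 (v : ℂ) (va : ℂ) (vb : ℂ) (vab : ℂ) (cm S) (cm Sa) (cm Sb) (cm Sab) := by
  simp only [D2, cm_sub, cm_smul]; push_cast; rfl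

theorem hSx_val (α : Fin 4) : hSx α (cvec qx) (cvec qx) = cm (qSx α) := by
  rw [hSx, A_inv]
  simp only [qSx, cm_S1, ← qX_val, ← qY_val, cm_mul, cm_sub, cvec_bas, gA_cast,
    gB_cast, gBs_cast, gC_cast]

theorem hSy_val (β : Fin 4) : hSy β (cvec qx) (cvec qx) = cm (qSy β) := by
  rw [hSy, A_inv]
  simp only [qSy, cm_S1, ← qX_val, ← qY_val, cm_mul, cm_sub, cvec_bas, gA_cast,
    gB_cast, gBs_cast, gC_cast]

theorem hSxy_val (α β : Fin 4) : hSxy α β (cvec qx) (cvec qx) = cm (qSxy α β) := by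
  rw [hSxy, A_inv]
  simp only [qSxy, cm_S2, ← qX_val, ← qY_val, cm_mul, cm_sub, cvec_bas, gA_cast,
    gB_cast, gBs_cast, gC_cast, mixd]

theorem dH_val (α : Fin 4) (i j : Fin 2) :
    dH α (cvec qx) (cvec qx) i j = ((qHx α i j : ℚ) : ℂ) := by
  rw [dH_eq α _ _ nu_ne A_det, hS_val, hSx_val, cvec_bas, gNu_cast, gNu_cast, ← Rat.cast_sub,
    ← cm_D1, qHx_val]
  rfl

theorem dbH_val (β : Fin 4) (i j : Fin 2) :
    dbH β (cvec qx) (cvec qx) i j = ((qHy β i j : ℚ) : ℂ) := by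
  rw [dbH_eq β _ _ nu_ne A_det, hS_val, hSy_val, cvec_bas, gNu_cast, gNu_cast, ← Rat.cast_sub,
    ← cm_D1, qHy_val]
  rfl

theorem ddH_val (α β : Fin 4) (i j : Fin 2) :
    ddH α β (cvec qx) (cvec qx) i j = ((qHxy α β i j : ℚ) : ℂ) := by
  have hm : mixd gNu α β (cvec qx) (cvec qx) = ((mixd gNu α β qx qx : ℚ) : ℂ) := by
    simp only [mixd, cvec_bas, gNu_cast]; push_cast; rfl
  rw [ddH_eq α β _ _ nu_ne A_det, hS_val, hSx_val, hSy_val, hSxy_val, hm, cvec_bas, cvec_bas,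
    gNu_cast, gNu_cast, gNu_cast, ← Rat.cast_sub, ← Rat.cast_sub, ← cm_D2, qHxy_val]
  rfl

theorem K_val : Kmat (cvec qx) = (2 : ℂ) • (1 : Matrix (Fin 2) (Fin 2) ℂ) := by
  ext i j
  have hst : ∀ a : Fin 4, star (cvec qx a) = cvec qx a := fun a => congrFun cconj_qx a
  have h := congrArg (fun q : ℚ => (q : ℂ)) (qK_val i j)
  have hR : ((2 : ℂ) • (1 : Matrix (Fin 2) (Fin 2) ℂ)) i j = ((if i = j then 2 else 0 : ℚ) : ℂ) := by
    by_cases hij : i = j <;> simp [hij]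
  rw [hR]
  refine Eq.trans ?_ h
  simp only [Kmat, Matrix.of_apply, gUp, cconj_qx, H_inv, dH_val, dbH_val, ddH_val, hst, nu_eq,
    gNu_cast]
  simp only [cvec, cm, Matrix.map_apply, Rat.coe_castHom]
  push_cast
  have hite : ∀ a b : Fin 4, ((if a = b then 1 else 0 : ℚ) : ℂ) = if a = b then 1 else 0 := by
    intro a b; by_cases hab : a = b <;> simp [hab]
  simp only [hite]

/-- at x¹ = (2,1,1,1), ν ≠ 0, Â and H = Ĥ(x¹, conj x¹) are
invertible, all the partial derivatives of Ĥ involved exist at (x¹, conj x¹),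
and the mean curvature satisfies K(x¹) = 2·I₂. -/
theorem horrocks_mumford_stmt12 :
    let x1 : Fin 4 → ℂ := ![2, 1, 1, 1]
    nu x1 (cconj x1) ≠ 0 ∧
    IsUnit (Ahat x1 (cconj x1)) ∧
    IsUnit (Hhat x1 (cconj x1)) ∧
    (∀ (α : Fin 4) (i j : Fin 2),
      DifferentiableAt ℂ (fun t : ℂ => Hhat (x1 + t • (Pi.single α 1 : Fin 4 → ℂ)) (cconj x1) i j) 0) ∧
    (∀ (β : Fin 4) (i j : Fin 2),
      DifferentiableAt ℂ (fun s : ℂ => Hhat x1 (cconj x1 + s • (Pi.single β 1 : Fin 4 → ℂ)) i j) 0) ∧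
    (∀ (α β : Fin 4) (i j : Fin 2),
      DifferentiableAt ℂ (fun s : ℂ => dH α x1 (cconj x1 + s • (Pi.single β 1 : Fin 4 → ℂ)) i j) 0) ∧
    Kmat x1 = (2 : ℂ) • (1 : Matrix (Fin 2) (Fin 2) ℂ) := by
  intro x1
  have hx : x1 = cvec qx := cvec_qx.symm
  rw [hx, cconj_qx]
  refine ⟨?_, ?_, ?_, ?_, ?_, ?_, K_val⟩
  · rw [nu_eq]; exact nu_ne
  · rw [Ahat_eq, Matrix.isUnit_iff_isUnit_det]
    exact isUnit_iff_ne_zero.mpr A_det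
  · rw [Matrix.isUnit_iff_isUnit_det]
    exact Matrix.isUnit_det_of_right_inverse H_mul
  · exact fun α i j => (Hhat_x α _ _ nu_ne A_det i j).differentiableAt
  · exact fun β i j => (Hhat_y β _ _ nu_ne A_det i j).differentiableAt
  · exact fun α β i j => (dH_y α β _ _ nu_ne A_det i j).differentiableAt
end
end
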